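/- arXiv:1710.06010 — 3 statements merged into one kernel-verified Lean document; each statement's English description precedes it below -/
import Mathlib

section
/- Let R be a Dedekind domain and let I and J be nonzero ideals of R. Then I ⊕ J is isomorphic to R ⊕ IJ as R-modules. -/
/-- If `I` and `J` are nonzero ideals of a Dedekind domain `R`, then
`I ⊕ J ≅ R ⊕ IJ` as `R`-modules. -/
theorem stmt_10 {R : Type*} [CommRing R] [IsDomain R] [IsDedekindDomain R]
    (I J : Ideal R) (hI : I ≠ ⊥) (hJ : J ≠ ⊥) :
    Nonempty ((↥I × ↥J) ≃ₗ[R] (R × ↥(I * J))) := by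
  obtain ⟨a, haI, ha⟩ := Submodule.exists_mem_ne_zero_of_ne_bot hI
  obtain ⟨I', hI'⟩ : I ∣ Ideal.span {a} :=
    Ideal.dvd_iff_le.2 ((Ideal.span_singleton_le_iff_mem I).2 haI)
  have hI'0 : I' ≠ ⊥ := by
    rintro rfl
    rw [Ideal.mul_bot, Ideal.span_singleton_eq_bot] at hI'
    exact ha hI'
  obtain ⟨b, hb⟩ := IsDedekindDomain.exists_sup_span_eq
    (Ideal.mul_le_right : J * I' ≤ I') (mul_ne_zero hJ hI'0)
  have hbI' : b ∈ I' := by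
    rw [← hb]
    exact Ideal.mem_sup_right (Ideal.mem_span_singleton_self b)
  -- the Bezout-type relation
  have key : a ∈ Ideal.span {a} * J ⊔ Ideal.span {b} * I := by
    have h : Ideal.span {a} * J ⊔ Ideal.span {b} * I = Ideal.span {a} := by
      calc _ = I * (J * I' ⊔ Ideal.span {b}) := by
            rw [Ideal.mul_sup, hI', mul_comm (Ideal.span {b}) I, mul_assoc, mul_comm I' J]
        _ = _ := by rw [hb, hI']
    rw [h]
    exact Ideal.mem_span_singleton_self a
  obtain ⟨u, hu, v, hv, huv⟩ := Submodule.mem_sup.1 key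
  obtain ⟨j, hj, rfl⟩ := Ideal.mem_span_singleton_mul.1 hu
  obtain ⟨i, hi, rfl⟩ := Ideal.mem_span_singleton_mul.1 hv
  -- multiplication by `b / a` as a map `I → R`
  have hex : ∀ x : I, ∃ r : R, a * r = b * x := by
    intro x
    have : b * (x : R) ∈ Ideal.span {a} := by
      rw [hI', mul_comm b]
      exact Ideal.mul_mem_mul x.2 hbI'
    obtain ⟨r, hr⟩ := Ideal.mem_span_singleton.1 this
    exact ⟨r, hr.symm⟩
  choose f hf using hex
  let φ : (I × J) →ₗ[R] (R × ↥(I * J)) :=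
    { toFun := fun p => (f p.1 + p.2, ⟨i * p.2 - j * p.1,
        Ideal.sub_mem _ (Ideal.mul_mem_mul hi p.2.2)
          (by rw [mul_comm j]; exact Ideal.mul_mem_mul p.1.2 hj)⟩)
      map_add' := by
        intro p q
        refine Prod.ext ?_ (Subtype.ext ?_)
        · apply mul_left_cancel₀ ha
          have h1 := hf (p.1 + q.1)
          have h2 := hf p.1
          have h3 := hf q.1
          simp only [Prod.fst_add, Prod.snd_add, Submodule.coe_add] at h1 ⊢
          linear_combination h1 - h2 - h3
        · simp only [Prod.fst_add, Prod.snd_add, Submodule.coe_add]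
          ring
      map_smul' := by
        intro r p
        refine Prod.ext ?_ (Subtype.ext ?_)
        · apply mul_left_cancel₀ ha
          have h1 := hf (r • p.1)
          have h2 := hf p.1
          simp only [Prod.smul_fst, Prod.smul_snd, Submodule.coe_smul, smul_eq_mul,
            RingHom.id_apply] at h1 ⊢
          linear_combination h1 - r * h2
        · simp only [Prod.smul_fst, Prod.smul_snd, Submodule.coe_smul, smul_eq_mul,
            RingHom.id_apply]
          ring }
  refine ⟨LinearEquiv.ofBijective φ ⟨?_, ?_⟩⟩
  · rw [← LinearMap.ker_eq_bot, LinearMap.ker_eq_bot']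
    intro p hp
    have h1 : f p.1 + (p.2 : R) = 0 := congrArg Prod.fst hp
    have h2 : i * (p.2 : R) - j * p.1 = 0 := congrArg (fun q => (q.2 : R)) hp
    have h3 := hf p.1
    refine Prod.ext (Subtype.ext ?_) (Subtype.ext ?_)
    · apply mul_left_cancel₀ ha
      change a * (p.1 : R) = a * 0
      linear_combination (-(p.1 : R)) * huv + a * i * h1 - a * h2 - i * h3
    · apply mul_left_cancel₀ ha
      change a * (p.2 : R) = a * 0
      linear_combination (-(p.2 : R)) * huv + a * j * h1 + b * h2 - j * h3
  · rintro ⟨r, s, hs⟩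
    have hbs : b * s ∈ Ideal.span {a} * J := by
      rw [hI', mul_comm I I', mul_assoc]
      exact Ideal.mul_mem_mul hbI' hs
    obtain ⟨t, ht, hts⟩ := Ideal.mem_span_singleton_mul.1 hbs
    let x : I := ⟨i * r - s, Ideal.sub_mem _ (Ideal.mul_mem_right _ _ hi) (Ideal.mul_le_left hs)⟩
    let y : J := ⟨j * r + t, Ideal.add_mem _ (Ideal.mul_mem_right _ _ hj) ht⟩
    have h3 : a * f x = b * (i * r - s) := hf x
    refine ⟨(x, y), Prod.ext ?_ (Subtype.ext ?_)⟩
    · apply mul_left_cancel₀ ha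
      change a * (f x + (j * r + t)) = a * r
      linear_combination h3 + hts + r * huv
    · apply mul_left_cancel₀ ha
      change a * (i * (j * r + t) - j * (i * r - s)) = a * s
      linear_combination i * hts + s * huv
end

section
/- Let R be a Dedekind domain and let m be a nonzero prime ideal of R. Then for nonnegative integers v and w, the R-module m^v / m^{v+w} is isomorphic to R / m^w. -/
/-- If `m` is a nonzero prime ideal of a Dedekind domain `R` and `v, w` are nonnegative
integers, then `m^v / m^(v+w) ≅ R / m^w` as `R`-modules. -/
theorem stmt_14 {R : Type*} [CommRing R] [IsDomain R] [IsDedekindDomain R]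
    (m : Ideal R) [m.IsPrime] (hm : m ≠ ⊥) (v w : ℕ) :
    Nonempty ((↥(m ^ v) ⧸ Submodule.comap (m ^ v).subtype (m ^ (v + w))) ≃ₗ[R]
      (R ⧸ m ^ w)) := by
  have hmax : m.IsMaximal := Ring.DimensionLEOne.maximalOfPrime hm inferInstance
  have hlt : m ^ (v + 1) < m ^ v :=
    Ideal.pow_right_strictAnti m hm (Ideal.IsPrime.ne_top inferInstance) (Nat.lt_succ_self v)
  obtain ⟨a, hav, ha⟩ := SetLike.exists_of_lt hlt
  obtain ⟨J, hJ⟩ : m ^ v ∣ Ideal.span {a} := by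
    rw [Ideal.dvd_iff_le, Ideal.span_singleton_le_iff_mem]; exact hav
  have hJm : ¬ J ≤ m := by
    intro h
    apply ha
    rw [← Ideal.span_singleton_le_iff_mem, hJ, pow_succ]
    exact Ideal.mul_mono_right h
  have hcop : IsCoprime m J := by
    rw [Ideal.isCoprime_iff_sup_eq]
    exact hmax.1.2 _ (lt_of_le_of_ne le_sup_left fun h => hJm (h ▸ le_sup_right))
  have hcopw : IsCoprime (m ^ w) J := hcop.pow_left
  have hmv : m ^ v ≠ 0 := pow_ne_zero v hm
  have key : ∀ r : R, r * a ∈ m ^ (v + w) ↔ r ∈ m ^ w := by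
    intro r
    rw [← Ideal.span_singleton_le_iff_mem, ← Ideal.span_singleton_le_iff_mem (m ^ w),
      ← Ideal.dvd_iff_le, ← Ideal.dvd_iff_le, ← Ideal.span_singleton_mul_span_singleton, hJ,
      mul_left_comm, pow_add, mul_dvd_mul_iff_left hmv]
    exact ⟨fun h => hcopw.dvd_of_dvd_mul_right h, fun h => h.mul_right J⟩
  have hsup : Ideal.span {a} ⊔ m ^ (v + w) = m ^ v := by
    rw [hJ, pow_add, ← Ideal.mul_sup, sup_comm, Ideal.isCoprime_iff_sup_eq.mp hcopw,
      Ideal.mul_top]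
  let N := Submodule.comap (m ^ v).subtype (m ^ (v + w))
  let f : R →ₗ[R] (↥(m ^ v) ⧸ N) :=
    N.mkQ.comp (LinearMap.toSpanSingleton R _ (⟨a, hav⟩ : ↥(m ^ v)))
  have hker : LinearMap.ker f = m ^ w := by
    ext r
    rw [← key r, LinearMap.mem_ker]
    exact Submodule.Quotient.mk_eq_zero N
  have hsurj : Function.Surjective f := by
    intro y
    obtain ⟨⟨x, hx⟩, rfl⟩ := N.mkQ_surjective y
    have hx' := hx
    rw [← hsup] at hx'
    obtain ⟨b, hb, c, hc, hbc⟩ := Submodule.mem_sup.mp hx'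
    obtain ⟨r, rfl⟩ := Ideal.mem_span_singleton'.mp hb
    refine ⟨r, (Submodule.Quotient.eq N).mpr ?_⟩
    change r * a - x ∈ m ^ (v + w)
    rw [← hbc, sub_add_cancel_left]
    exact neg_mem hc
  exact ⟨((Submodule.quotEquivOfEq _ _ hker.symm).trans
    (f.quotKerEquivOfSurjective hsurj)).symm⟩
end

section
/- Let R be a Dedekind domain and let M and N be finitely generated R-modules. Then the supremum of the nonnegative integers t such that there exists an injective R-linear map from N^t into M equals the infimum over associated primes p of N of the corresponding local quantity: the supremum of t such that N_p^t embeds into M_p over R_p. -/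
open Function

/-- The global injective capacity of `M` with respect to `N`: the supremum (in `ℕ∞`) of
the nonnegative integers `t` such that there is an injective linear map `N^t → M`. -/
noncomputable def injCap (R M N : Type*) [CommRing R] [AddCommGroup M] [Module R M]
    [AddCommGroup N] [Module R N] : ℕ∞ :=
  sSup {c : ℕ∞ | ∃ t : ℕ, c = t ∧ ∃ f : (Fin t → N) →ₗ[R] M, Injective f}

lemma le_injCap_iff (R M N : Type*) [CommRing R] [AddCommGroup M] [Module R M]
    [AddCommGroup N] [Module R N] (n : ℕ) :
    (n : ℕ∞) ≤ injCap R M N ↔ ∃ f : (Fin n → N) →ₗ[R] M, Injective f := by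
  constructor
  · intro h
    rcases n with _ | n
    · exact ⟨0, fun x y _ => Subsingleton.elim x y⟩
    · have h1 : (n : ℕ∞) < injCap R M N :=
        lt_of_lt_of_le (by exact_mod_cast Nat.lt_succ_self n) h
      obtain ⟨c, ⟨t, rfl, f, hf⟩, hc⟩ := lt_sSup_iff.mp h1
      have hnt : n + 1 ≤ t := by exact_mod_cast hc
      refine ⟨f ∘ₗ LinearMap.funLeft R N (fun i : Fin t =>
        if hi : i.1 < n + 1 then (⟨i.1, hi⟩ : Fin (n+1)) else 0), ?_⟩
      rw [LinearMap.coe_comp]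
      refine hf.comp (LinearMap.funLeft_injective_of_surjective _ _ _ ?_)
      intro j
      exact ⟨⟨j.1, by omega⟩, dif_pos j.2⟩
  · rintro ⟨f, hf⟩
    exact le_sSup ⟨n, rfl, f, hf⟩

lemma exists_torsion_embed {R M P : Type*} [CommRing R] [IsDomain R] [IsDedekindDomain R]
    [AddCommGroup M] [Module R M]
    [AddCommGroup P] [Module R P] [Module.Finite R P]
    (H : ∀ p ∈ associatedPrimes R P, ∃ h : P →ₗ[R] M, ∀ x, h x = 0 → ∃ s, s ∉ p ∧ s • x = 0) :
    ∃ h : P →ₗ[R] M, ∀ x ∈ Submodule.torsion R P, h x = 0 → x = 0 := by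
  classical
  have hfin : (associatedPrimes R P \ {⊥}).Finite := (associatedPrimes.finite R P).sdiff
  set A := hfin.toFinset with hA
  have hmem : ∀ p, p ∈ A ↔ p ∈ associatedPrimes R P ∧ p ≠ ⊥ := by
    intro p; simp [hA]
  have key : ∀ p : Ideal R, ∃ a : R, ∃ h : P →ₗ[R] M, p ∈ A →
      (a ∉ p ∧ (∀ q ∈ A, q ≠ p → a ∈ q) ∧ ∀ x, h x = 0 → ∃ s, s ∉ p ∧ s • x = 0) := by
    intro p
    by_cases hp : p ∈ A
    · obtain ⟨hp1, hp0⟩ := (hmem p).1 hp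
      obtain ⟨h, hh⟩ := H p hp1
      have hpp : p.IsPrime := hp1.1
      have : ¬ (∏ q ∈ A.erase p, q) ≤ p := by
        rw [hpp.prod_le]
        rintro ⟨q, hq, hqp⟩
        obtain ⟨hqne, hqA⟩ := Finset.mem_erase.1 hq
        obtain ⟨hq1, hq0⟩ := (hmem q).1 hqA
        have hqm : q.IsMaximal := Ideal.IsPrime.isMaximal hq1.1 hq0
        exact hqne (hqm.eq_of_le hpp.ne_top hqp)
      obtain ⟨a, ha, hap⟩ := SetLike.not_le_iff_exists.1 this
      refine ⟨a, h, fun _ => ⟨hap, fun q hq hqp => ?_, hh⟩⟩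
      have := Ideal.prod_le_inf ha
      exact (Finset.inf_le (f := fun q : Ideal R => q) (Finset.mem_erase.2 ⟨hqp, hq⟩)) this
    · exact ⟨0, 0, fun h => absurd h hp⟩
  choose a h hah using key
  refine ⟨∑ p ∈ A, a p • h p, ?_⟩
  set f : P →ₗ[R] M := ∑ p ∈ A, a p • h p with hf
  set K : Submodule R P := Submodule.torsion R P ⊓ LinearMap.ker f with hK
  by_contra hcon
  push Not at hcon
  obtain ⟨x, hxT, hfx, hx0⟩ := hcon
  have hnt : Nontrivial K := ⟨⟨⟨x, hxT, hfx⟩, 0, fun e => hx0 (congrArg Subtype.val e)⟩⟩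
  obtain ⟨p, hp⟩ := associatedPrimes.nonempty R K
  have hpP : p ∈ associatedPrimes R P :=
    associatedPrimes.subset_of_injective (f := K.subtype) K.injective_subtype hp
  obtain ⟨hpp, ⟨y, hyT, hyf⟩, hpy⟩ := isAssociatedPrime_iff.1 hp
  have hpy' : ∀ r, r ∈ p ↔ r • y = 0 := by
    intro r
    rw [hpy, Submodule.mem_colon_singleton, Submodule.mem_bot, Subtype.ext_iff]
    rfl
  have hp0 : p ≠ ⊥ := by
    rintro rfl
    obtain ⟨r, hr⟩ := (Submodule.mem_torsion_iff y).1 hyT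
    exact nonZeroDivisors.coe_ne_zero r ((hpy' r).2 hr)
  have hpA : p ∈ A := (hmem p).2 ⟨hpP, hp0⟩
  have h1 : f y = h p (a p • y) := by
    rw [hf, LinearMap.sum_apply, Finset.sum_eq_single p]
    · simp
    · intro q hq hqp
      have := (hah q hq).2.1 p hpA hqp.symm
      rw [LinearMap.smul_apply, ← map_smul, (hpy' _).1 this, map_zero]
    · exact fun hh => absurd hpA hh
  obtain ⟨s, hs, hsy⟩ := (hah p hpA).2.2 (a p • y) (h1 ▸ hyf)
  rw [smul_smul, ← hpy'] at hsy
  rcases hpp.mem_or_mem hsy with h | h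
  · exact hs h
  · exact (hah p hpA).1 h

lemma exists_embed {R M P : Type*} [CommRing R] [IsDomain R] [IsDedekindDomain R]
    [AddCommGroup M] [Module R M]
    [AddCommGroup P] [Module R P] [Module.Finite R P]
    (H : ∀ p ∈ associatedPrimes R P, ∃ h : P →ₗ[R] M, ∀ x, h x = 0 → ∃ s, s ∉ p ∧ s • x = 0) :
    ∃ h : P →ₗ[R] M, Injective h := by
  obtain ⟨hT, hhT⟩ := exists_torsion_embed H
  have htf : Module.IsTorsionFree R (P ⧸ Submodule.torsion R P) :=
    Submodule.isTorsionFree_iff_torsion_eq_bot.2 Submodule.QuotientTorsion.torsion_eq_bot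
  have hfp : Module.FinitePresentation R (P ⧸ Submodule.torsion R P) :=
    Module.finitePresentation_of_finite R _
  have hproj : Module.Projective R (P ⧸ Submodule.torsion R P) :=
    Module.Flat.projective_of_finitePresentation
  obtain ⟨σ, hσ⟩ := Module.projective_lifting_property _ LinearMap.id
    (Submodule.torsion R P).mkQ_surjective
  have hσ' : ∀ q, (Submodule.torsion R P).mkQ (σ q) = q := fun q => LinearMap.congr_fun hσ q
  have hF : ∃ g : (P ⧸ Submodule.torsion R P) →ₗ[R] M, ∀ q, g q = 0 → q = 0 := by
    rcases subsingleton_or_nontrivial (P ⧸ Submodule.torsion R P) with hs | hn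
    · exact ⟨0, fun q _ => Subsingleton.elim _ _⟩
    · obtain ⟨q, hq⟩ := exists_ne (0 : P ⧸ Submodule.torsion R P)
      have hbot : (⊥ : Ideal R) ∈ associatedPrimes R P := by
        refine isAssociatedPrime_iff.2 ⟨Ideal.isPrime_bot, σ q, ?_⟩
        ext r
        rw [Submodule.mem_colon_singleton, Submodule.mem_bot, Submodule.mem_bot]
        constructor
        · rintro rfl; simp
        · intro h
          rw [← map_smul] at h
          have h2 := hσ' (r • q)
          rw [h, map_zero] at h2
          exact (smul_eq_zero.1 h2.symm).resolve_right hq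
      obtain ⟨h, hh⟩ := H ⊥ hbot
      refine ⟨h ∘ₗ σ, fun q hq => ?_⟩
      obtain ⟨s, hs, hsq⟩ := hh (σ q) hq
      rw [← map_smul] at hsq
      have h2 := hσ' (s • q)
      rw [hsq, map_zero] at h2
      exact (smul_eq_zero.1 h2.symm).resolve_left hs
  obtain ⟨g, hg⟩ := hF
  set π := (Submodule.torsion R P).mkQ with hπ
  refine ⟨hT ∘ₗ (LinearMap.id - σ ∘ₗ π) + g ∘ₗ π, ?_⟩
  rw [injective_iff_map_eq_zero]
  intro x hx
  have hxT : x - σ (π x) ∈ Submodule.torsion R P := by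
    have h0 : π (x - σ (π x)) = 0 := by rw [map_sub, hσ', sub_self]
    exact (Submodule.Quotient.mk_eq_zero _).1 h0
  have hx' : hT (x - σ (π x)) + g (π x) = 0 := by simpa using hx
  obtain ⟨r, hr⟩ := (Submodule.mem_torsion_iff _).1 hxT
  have hr' : (r : R) • (x - σ (π x)) = 0 := hr
  have h1 : g ((r : R) • π x) = 0 := by
    have := congrArg (fun z => (r : R) • z) hx'
    simpa only [smul_add, ← map_smul, hr', map_zero, zero_add, smul_zero] using this
  have h2 : π x = 0 := (smul_eq_zero.1 (hg _ h1)).resolve_left (nonZeroDivisors.coe_ne_zero r)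
  rw [h2] at hx' hxT
  simp only [map_zero, sub_zero, add_zero] at hx' hxT
  exact hhT x hxT hx'

lemma associatedPrimes_pi_subset {R N : Type*} [CommRing R] [IsNoetherianRing R]
    [AddCommGroup N] [Module R N] (n : ℕ) :
    associatedPrimes R (Fin n → N) ⊆ associatedPrimes R N := by
  intro p hp
  obtain ⟨hpp, x, hx⟩ := isAssociatedPrime_iff.1 hp
  have hx' : ∀ r, r ∈ p ↔ ∀ i, r • x i = 0 := by
    intro r
    rw [hx, Submodule.mem_colon_singleton, Submodule.mem_bot, funext_iff]
    rfl
  have hle : (Finset.univ.inf fun i => (⊥ : Submodule R N).colon {x i}) ≤ p := by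
    intro r hr
    rw [Submodule.mem_finsetInf] at hr
    rw [hx']
    intro i
    simpa [Submodule.mem_colon_singleton] using hr i (Finset.mem_univ i)
  obtain ⟨i, -, hi⟩ := (hpp.inf_le').1 hle
  refine isAssociatedPrime_iff.2 ⟨hpp, x i, le_antisymm ?_ hi⟩
  intro r hr
  rw [Submodule.mem_colon_singleton, Submodule.mem_bot]
  exact (hx' r).1 hr i

/-- The localization map on finite powers. -/
noncomputable abbrev locPi {R : Type*} (N : Type*) [CommRing R]
    [AddCommGroup N] [Module R N] (S : Submonoid R) (n : ℕ) :
    (Fin n → N) →ₗ[R] (Fin n → LocalizedModule S N) :=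
  LinearMap.pi fun i => LocalizedModule.mkLinearMap S N ∘ₗ LinearMap.proj i

lemma local_of_global {R M N : Type*} [CommRing R] [AddCommGroup M] [Module R M]
    [AddCommGroup N] [Module R N] (S : Submonoid R) (n : ℕ)
    (f : (Fin n → N) →ₗ[R] M) (hf : Injective f) :
    ∃ g : (Fin n → LocalizedModule S N) →ₗ[Localization S] LocalizedModule S M, Injective g := by
  refine ⟨IsLocalizedModule.mapExtendScalars S (locPi N S n)
    (LocalizedModule.mkLinearMap S M) (Localization S) f, ?_⟩
  exact IsLocalizedModule.map_injective S (locPi N S n) (LocalizedModule.mkLinearMap S M) f hf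

lemma global_of_local {R M N : Type*} [CommRing R] [IsNoetherianRing R]
    [AddCommGroup M] [Module R M]
    [AddCommGroup N] [Module R N] [Module.Finite R N] (S : Submonoid R) (n : ℕ)
    (g : (Fin n → LocalizedModule S N) →ₗ[Localization S] LocalizedModule S M)
    (hg : Injective g) :
    ∃ h : (Fin n → N) →ₗ[R] M, ∀ x, h x = 0 → ∃ s ∈ S, s • x = 0 := by
  have : Module.FinitePresentation R (Fin n → N) := Module.finitePresentation_of_finite R _
  obtain ⟨h, s, hs⟩ := Module.FinitePresentation.exists_lift_of_isLocalizedModule S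
    (LocalizedModule.mkLinearMap S M) (g.restrictScalars R ∘ₗ locPi N S n)
  refine ⟨h, fun x hx => ?_⟩
  have h1 := LinearMap.congr_fun hs x
  have h2 : (s : R) • g (locPi N S n x) = 0 := by
    rw [LinearMap.comp_apply, hx, map_zero] at h1
    exact h1.symm
  have h3 : g (locPi N S n ((s : R) • x)) = 0 := by
    rw [map_smul, ← h2]
    exact (g.restrictScalars R).map_smul (s : R) _
  have h4 : locPi N S n ((s : R) • x) = 0 := hg (by rw [h3, map_zero])
  obtain ⟨c, hc⟩ := (IsLocalizedModule.eq_zero_iff S (locPi N S n)).1 h4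
  refine ⟨c * s, (c * s).2, ?_⟩
  rw [mul_smul]
  exact hc

/-- For finitely generated modules `M`, `N` over a Dedekind domain `R`, the global
injective capacity of `M` with respect to `N` equals the infimum, over the associated
primes `p` of `N`, of the local injective capacities of `M_p` with respect to `N_p`. -/
theorem stmt_16 {R M N : Type*} [CommRing R] [IsDomain R] [IsDedekindDomain R]
    [AddCommGroup M] [Module R M] [Module.Finite R M]
    [AddCommGroup N] [Module R N] [Module.Finite R N] :
    injCap R M N =
      ⨅ p : {p : Ideal R // p ∈ associatedPrimes R N},
        injCap (Localization (@Ideal.primeCompl R _ p.1 p.2.1))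
          (LocalizedModule (@Ideal.primeCompl R _ p.1 p.2.1) M)
          (LocalizedModule (@Ideal.primeCompl R _ p.1 p.2.1) N) := by
  refine le_antisymm ?_ ?_
  · refine le_iInf fun p => ENat.forall_natCast_le_iff_le.1 fun n hn => ?_
    obtain ⟨f, hf⟩ := (le_injCap_iff _ _ _ n).1 hn
    exact (le_injCap_iff _ _ _ n).2 (local_of_global _ n f hf)
  · refine ENat.forall_natCast_le_iff_le.1 fun n hn => ?_
    refine (le_injCap_iff _ _ _ n).2 (exists_embed fun p hp => ?_)
    have hp' := associatedPrimes_pi_subset n hp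
    obtain ⟨g, hg⟩ := (le_injCap_iff _ _ _ n).1 (hn.trans (iInf_le _ ⟨p, hp'⟩))
    exact global_of_local _ n g hg
end
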